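/- arXiv:2403.09279 — 7 statements merged into one kernel-verified Lean document; each statement's English description precedes it below -/
import Mathlib

section
/- Fix an integer L ≥ 1, a real r ∈ (0,1), an integer M ≥ 1, nonnegative reals p_0,...,p_M with Σ_{j=0}^{M} p_j = 1, a holding cost C > 0, a tax λ ∈ ℝ, and a discount factor β ∈ (0,1). If W : ℕ → ℝ is strictly increasing, then the function T W : ℕ → ℝ defined by (T W)(x) = min( C·x + β·Σ_{d=0}^{L} P_d · Σ_{j=0}^{M} p_j · W(max(x−d,0) + j) , C·x + λ + β·Σ_{d=0}^{L} P_d · W(max(x−d,0)) ) is also strictly increasing; that is, x1 > x2 implies (T W)(x1) > (T W)(x2). -/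
/-- the one-step Bellman operator preserves strict monotonicity. -/
theorem stmt_1 (L M : ℕ) (hL : 1 ≤ L) (hM : 1 ≤ M)
    (r : ℝ) (hr0 : 0 < r) (hr1 : r < 1)
    (p : ℕ → ℝ) (hp : ∀ j, 0 ≤ p j)
    (hpsum : ∑ j ∈ Finset.range (M + 1), p j = 1)
    (C : ℝ) (hC : 0 < C) (lam : ℝ) (β : ℝ) (hβ0 : 0 < β) (hβ1 : β < 1)
    (W : ℕ → ℝ) (hW : StrictMono W) :
    StrictMono (fun x : ℕ =>
      min
        (C * (x : ℝ) + β * ∑ d ∈ Finset.range (L + 1),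
          ((L.choose d : ℝ) * r ^ d * (1 - r) ^ (L - d)) *
            ∑ j ∈ Finset.range (M + 1), p j * W (x - d + j))
        (C * (x : ℝ) + lam + β * ∑ d ∈ Finset.range (L + 1),
          ((L.choose d : ℝ) * r ^ d * (1 - r) ^ (L - d)) * W (x - d))) := by
  intro x y hxy
  have hxy' : C * (x : ℝ) < C * (y : ℝ) := by gcongr
  have hr : 0 ≤ 1 - r := by linarith
  have hmono (j d : ℕ) : W (x - d + j) ≤ W (y - d + j) := hW.monotone (by omega)
  refine min_lt_min (add_lt_add_of_lt_of_le hxy' ?_)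
    (add_lt_add_of_lt_of_le (add_lt_add_left hxy' lam) ?_)
  · refine mul_le_mul_of_nonneg_left (Finset.sum_le_sum fun d _ => ?_) hβ0.le
    exact mul_le_mul_of_nonneg_left
      (Finset.sum_le_sum fun j _ => mul_le_mul_of_nonneg_left (hmono j d) (hp j)) (by positivity)
  · refine mul_le_mul_of_nonneg_left (Finset.sum_le_sum fun d _ => ?_) hβ0.le
    exact mul_le_mul_of_nonneg_left (hmono 0 d) (by positivity)
end

section
/- Fix an integer L ≥ 1, a real r ∈ (0,1), an integer M ≥ 1, nonnegative reals p_0,...,p_M with Σ_{j=0}^{M} p_j = 1, a holding cost C > 0, a tax λ ∈ ℝ, and a discount factor β ∈ (0,1). Define V_0(x) = C·x for x ∈ ℕ and, for s ≥ 0, V_{s+1}(x) = min( C·x + β·Σ_{d=0}^{L} P_d · Σ_{j=0}^{M} p_j · V_s(max(x−d,0) + j) , C·x + λ + β·Σ_{d=0}^{L} P_d · V_s(max(x−d,0)) ). Then for every s ∈ ℕ, V_s is strictly increasing: x1 > x2 implies V_s(x1) > V_s(x2). -/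
/-- The `s`-step finite-horizon β-discounted value function of the
single-station admission-control MDP (state space ℕ, truncated subtraction
plays the role of `max(x − d, 0)`). -/
noncomputable def valueFn (L M : ℕ) (r C lam β : ℝ) (p : ℕ → ℝ) : ℕ → ℕ → ℝ
  | 0, x => C * (x : ℝ)
  | s + 1, x =>
      min
        (C * (x : ℝ) + β * ∑ d ∈ Finset.range (L + 1),
          ((L.choose d : ℝ) * r ^ d * (1 - r) ^ (L - d)) *
            ∑ j ∈ Finset.range (M + 1), p j * valueFn L M r C lam β p s (x - d + j))
        (C * (x : ℝ) + lam + β * ∑ d ∈ Finset.range (L + 1),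
          ((L.choose d : ℝ) * r ^ d * (1 - r) ^ (L - d)) * valueFn L M r C lam β p s (x - d))

/-- every finite-horizon value function `V_s` is strictly increasing. -/
theorem stmt_2 (L M : ℕ) (hL : 1 ≤ L) (hM : 1 ≤ M)
    (r : ℝ) (hr0 : 0 < r) (hr1 : r < 1)
    (p : ℕ → ℝ) (hp : ∀ j, 0 ≤ p j)
    (hpsum : ∑ j ∈ Finset.range (M + 1), p j = 1)
    (C : ℝ) (hC : 0 < C) (lam : ℝ) (β : ℝ) (hβ0 : 0 < β) (hβ1 : β < 1) :
    ∀ s : ℕ, StrictMono (valueFn L M r C lam β p s) := by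
  intro s
  induction s with
  | zero =>
    intro x y hxy
    simp only [valueFn]
    gcongr
  | succ s ih =>
    have hP : ∀ d, 0 ≤ (L.choose d : ℝ) * r ^ d * (1 - r) ^ (L - d) := fun d => by
      have : 0 ≤ 1 - r := by linarith
      positivity
    intro x y hxy
    have hcost : C * (x : ℝ) < C * (y : ℝ) := by gcongr
    simp only [valueFn]
    refine min_lt_min (add_lt_add_of_lt_of_le hcost ?_)
      (add_lt_add_of_lt_of_le (by linarith) ?_)
    · refine mul_le_mul_of_nonneg_left (Finset.sum_le_sum fun d _ =>
        mul_le_mul_of_nonneg_left (Finset.sum_le_sum fun j _ =>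
          mul_le_mul_of_nonneg_left (ih.monotone (by omega)) (hp j)) (hP d)) hβ0.le
    · refine mul_le_mul_of_nonneg_left (Finset.sum_le_sum fun d _ =>
        mul_le_mul_of_nonneg_left (ih.monotone (by omega)) (hP d)) hβ0.le
end

section
/- Fix an integer L ≥ 1, a real r ∈ (0,1), an integer M ≥ 1, nonnegative reals p_0,...,p_M with Σ_{j=0}^{M} p_j = 1, a holding cost C > 0, a tax λ ∈ ℝ, and a discount factor β ∈ (0,1). Define V_0(x) = C·x for x ∈ [0,∞) and, for s ≥ 0, V_{s+1}(x) = inf over μ ∈ [0,1] of [ C·x + (1−μ)·λ + β·Σ_{d=0}^{L} P_d · Σ_{j=0}^{M} p_j · V_s( x − min(x,d) + μ·j ) ]. Then for every s ∈ ℕ, V_s is convex and monotone non-decreasing on [0, ∞). -/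
/-- The `s`-step finite-horizon β-discounted value function of the relaxed
admission-control problem: the state space is relaxed from ℕ to `[0, ∞)` and
the control space from `{0, 1}` to `[0, 1]`. -/
noncomputable def relaxedValueFn (L M : ℕ) (r C lam β : ℝ) (p : ℕ → ℝ) : ℕ → ℝ → ℝ
  | 0, x => C * x
  | s + 1, x =>
      sInf ((fun μ : ℝ =>
        C * x + (1 - μ) * lam + β * ∑ d ∈ Finset.range (L + 1),
          ((L.choose d : ℝ) * r ^ d * (1 - r) ^ (L - d)) *
            ∑ j ∈ Finset.range (M + 1),
              p j * relaxedValueFn L M r C lam β p s (x - min x (d : ℝ) + μ * (j : ℝ)))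
        '' Set.Icc (0 : ℝ) 1)

/-- Partial minimisation over `T` of a jointly convex function is convex. -/
theorem convexOn_sInf_image {S T : Set ℝ} {Q : ℝ → ℝ → ℝ} (hT : T.Nonempty)
    (hQ : ConvexOn ℝ (S ×ˢ T) fun z : ℝ × ℝ => Q z.1 z.2)
    (hS : Convex ℝ S) (hbdd : ∀ x ∈ S, BddBelow (Q x '' T)) :
    ConvexOn ℝ S fun x => sInf (Q x '' T) := by
  refine ⟨hS, fun x hx y hy a b ha hb hab => le_of_forall_pos_le_add fun ε hε => ?_⟩
  obtain ⟨_, ⟨μ, hμ, rfl⟩, hμε⟩ :=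
    exists_lt_of_csInf_lt (hT.image (Q x)) (lt_add_of_pos_right _ hε)
  obtain ⟨_, ⟨ν, hν, rfl⟩, hνε⟩ :=
    exists_lt_of_csInf_lt (hT.image (Q y)) (lt_add_of_pos_right _ hε)
  have hmem : (x, μ) ∈ S ×ˢ T := ⟨hx, hμ⟩
  have hmem' : (y, ν) ∈ S ×ˢ T := ⟨hy, hν⟩
  have hconv := hQ.2 hmem hmem' ha hb hab
  have hin := hQ.1 hmem hmem' ha hb hab
  have hle := csInf_le (hbdd _ hin.1) (Set.mem_image_of_mem _ hin.2)
  simp only [Prod.smul_mk, Prod.mk_add_mk, smul_eq_mul] at hconv hle ⊢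
  calc sInf (Q (a * x + b * y) '' T) ≤ a * Q x μ + b * Q y ν := hle.trans hconv
    _ ≤ a * (sInf (Q x '' T) + ε) + b * (sInf (Q y '' T) + ε) := by gcongr
    _ = a * sInf (Q x '' T) + b * sInf (Q y '' T) + ε := by
      linear_combination ε * hab

/-- Partial minimisation over `T` preserves monotonicity in the remaining variable. -/
theorem monotoneOn_sInf_image {S T : Set ℝ} {Q : ℝ → ℝ → ℝ} (hT : T.Nonempty)
    (hQ : ∀ μ ∈ T, MonotoneOn (fun x => Q x μ) S) (hbdd : ∀ x ∈ S, BddBelow (Q x '' T)) :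
    MonotoneOn (fun x => sInf (Q x '' T)) S := by
  intro x hx y hy hxy
  refine le_csInf (hT.image _) ?_
  rintro _ ⟨μ, hμ, rfl⟩
  exact (csInf_le (hbdd x hx) (Set.mem_image_of_mem _ hμ)).trans (hQ μ hμ hx hy hxy)

theorem sub_min_add_mul_nonneg {x μ d j : ℝ} (hμ : 0 ≤ μ) (hj : 0 ≤ j) :
    0 ≤ x - min x d + μ * j :=
  add_nonneg (sub_nonneg.2 (min_le_left x d)) (mul_nonneg hμ hj)

theorem sub_min_mono {x y : ℝ} (d : ℝ) (hxy : x ≤ y) : x - min x d ≤ y - min y d := by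
  rcases min_cases x d with h | h <;> rcases min_cases y d with h' | h' <;> linarith

/-- The post-transition value is jointly convex in the queue length and the control. -/
theorem ConvexOn.comp_sub_min_add_mul {V : ℝ → ℝ} (hV : ConvexOn ℝ (Set.Ici 0) V)
    (hmono : MonotoneOn V (Set.Ici 0)) {d j : ℝ} (hj : 0 ≤ j) :
    ConvexOn ℝ (Set.Ici (0 : ℝ) ×ˢ Set.Icc (0 : ℝ) 1)
      fun z : ℝ × ℝ => V (z.1 - min z.1 d + z.2 * j) := by
  refine ⟨(convex_Ici 0).prod (convex_Icc 0 1), ?_⟩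
  rintro ⟨x, μ⟩ ⟨-, hμ⟩ ⟨y, ν⟩ ⟨-, hν⟩ a b ha hb hab
  have hx := sub_min_add_mul_nonneg (x := x) (d := d) hμ.1 hj
  have hy := sub_min_add_mul_nonneg (x := y) (d := d) hν.1 hj
  refine le_trans (hmono ?_ ?_ ?_) (hV.2 hx hy ha hb hab)
  · exact sub_min_add_mul_nonneg
      (add_nonneg (mul_nonneg ha hμ.1) (mul_nonneg hb hν.1)) hj
  · exact add_nonneg (mul_nonneg ha hx) (mul_nonneg hb hy)
  · have hmin : a * min x d + b * min y d ≤ min (a * x + b * y) d := by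
      refine le_min ?_ ?_
      · gcongr <;> exact min_le_left _ _
      · calc a * min x d + b * min y d ≤ a * d + b * d := by
              gcongr <;> exact min_le_right _ _
          _ = d := by rw [← add_mul, hab, one_mul]
    simp only [Prod.smul_mk, Prod.mk_add_mk, smul_eq_mul]
    linarith

/-- A finite sum of convex functions is convex. -/
theorem convexOn_finset_sum {ι E : Type*} [AddCommGroup E] [Module ℝ E] {S : Set E}
    (hS : Convex ℝ S) (t : Finset ι) {f : ι → E → ℝ} (hf : ∀ i ∈ t, ConvexOn ℝ S (f i)) :
    ConvexOn ℝ S fun x => ∑ i ∈ t, f i x := by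
  refine ⟨hS, fun x hx y hy a b ha hb hab => ?_⟩
  simp only [Finset.smul_sum, ← Finset.sum_add_distrib]
  exact Finset.sum_le_sum fun i hi => (hf i hi).2 hx hy ha hb hab

/-- every relaxed finite-horizon value function `V_s` is convex and
monotone non-decreasing on `[0, ∞)`. -/
theorem stmt_4 (L M : ℕ) (hL : 1 ≤ L) (hM : 1 ≤ M)
    (r : ℝ) (hr0 : 0 < r) (hr1 : r < 1)
    (p : ℕ → ℝ) (hp : ∀ j, 0 ≤ p j)
    (hpsum : ∑ j ∈ Finset.range (M + 1), p j = 1)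
    (C : ℝ) (hC : 0 < C) (lam : ℝ) (β : ℝ) (hβ0 : 0 < β) (hβ1 : β < 1) :
    ∀ s : ℕ,
      ConvexOn ℝ (Set.Ici (0 : ℝ)) (relaxedValueFn L M r C lam β p s) ∧
      MonotoneOn (relaxedValueFn L M r C lam β p s) (Set.Ici (0 : ℝ)) := by
  have hP : ∀ d, 0 ≤ (L.choose d : ℝ) * r ^ d * (1 - r) ^ (L - d) := fun d => by
    have : 0 ≤ 1 - r := by linarith
    positivity
  have hT : (Set.Icc (0 : ℝ) 1).Nonempty := ⟨0, by simp⟩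
  intro s
  induction s with
  | zero =>
    simp only [relaxedValueFn]
    refine ⟨?_, fun x _ y _ hxy => mul_le_mul_of_nonneg_left hxy hC.le⟩
    simpa only [smul_eq_mul, id] using (convexOn_id (𝕜 := ℝ) (convex_Ici (0 : ℝ))).smul hC.le
  | succ s ih =>
    obtain ⟨hconv, hmono⟩ := ih
    generalize hV : relaxedValueFn L M r C lam β p s = V at hconv hmono
    let Q : ℝ → ℝ → ℝ := fun x μ => C * x + (1 - μ) * lam + β * ∑ d ∈ Finset.range (L + 1),
      ((L.choose d : ℝ) * r ^ d * (1 - r) ^ (L - d)) *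
        ∑ j ∈ Finset.range (M + 1), p j * V (x - min x (d : ℝ) + μ * (j : ℝ))
    have hsucc : relaxedValueFn L M r C lam β p (s + 1)
        = fun x => sInf (Q x '' Set.Icc (0 : ℝ) 1) := by
      funext x
      simp only [relaxedValueFn, hV, Q]
    have hbdd : ∀ x ∈ Set.Ici (0 : ℝ), BddBelow (Q x '' Set.Icc (0 : ℝ) 1) := by
      intro x hx
      refine ⟨C * x + -|lam| + β * ∑ d ∈ Finset.range (L + 1),
        ((L.choose d : ℝ) * r ^ d * (1 - r) ^ (L - d)) *
          ∑ j ∈ Finset.range (M + 1), p j * V 0, ?_⟩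
      rintro _ ⟨μ, hμ, rfl⟩
      refine add_le_add (add_le_add le_rfl ?_) (mul_le_mul_of_nonneg_left
        (Finset.sum_le_sum fun d _ => mul_le_mul_of_nonneg_left
          (Finset.sum_le_sum fun j _ => mul_le_mul_of_nonneg_left ?_ (hp j)) (hP d)) hβ0.le)
      · nlinarith [neg_abs_le lam, abs_nonneg lam, hμ.1, hμ.2]
      · have hnext := sub_min_add_mul_nonneg (x := x) (d := d) hμ.1 (Nat.cast_nonneg j)
        exact hmono Set.self_mem_Ici hnext hnext
    rw [hsucc]
    refine ⟨convexOn_sInf_image hT ?_ (convex_Ici 0) hbdd, monotoneOn_sInf_image hT ?_ hbdd⟩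
    · have hST : Convex ℝ (Set.Ici (0 : ℝ) ×ˢ Set.Icc (0 : ℝ) 1) :=
        (convex_Ici 0).prod (convex_Icc 0 1)
      refine ConvexOn.add (f := fun z : ℝ × ℝ => C * z.1 + (1 - z.2) * lam)
        ⟨hST, fun x _ y _ a b _ _ hab => le_of_eq ?_⟩ (ConvexOn.smul hβ0.le
          (convexOn_finset_sum hST _ fun d _ => ConvexOn.smul (hP d)
            (convexOn_finset_sum hST _ fun j _ => ConvexOn.smul (hp j)
              (hconv.comp_sub_min_add_mul hmono (Nat.cast_nonneg j)))))
      simp only [Prod.fst_add, Prod.snd_add, Prod.smul_fst, Prod.smul_snd, smul_eq_mul]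
      linear_combination -lam * hab
    · intro μ hμ x hx y hy hxy
      refine add_le_add (add_le_add (mul_le_mul_of_nonneg_left hxy hC.le) le_rfl)
        (mul_le_mul_of_nonneg_left
          (Finset.sum_le_sum fun d _ => mul_le_mul_of_nonneg_left
            (Finset.sum_le_sum fun j _ => mul_le_mul_of_nonneg_left ?_ (hp j)) (hP d)) hβ0.le)
      exact hmono (sub_min_add_mul_nonneg hμ.1 (Nat.cast_nonneg j))
        (sub_min_add_mul_nonneg hμ.1 (Nat.cast_nonneg j))
        (add_le_add (sub_min_mono d hxy) le_rfl)
end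

section
/- Let W : [0,∞) → ℝ be convex and monotone non-decreasing, and fix an integer L ≥ 1, a real r ∈ (0,1), an integer M ≥ 1, nonnegative reals p_0,...,p_M with Σ_{j=0}^{M} p_j = 1, a real C > 0, a real λ, and β ∈ (0,1). Then the function x ↦ inf over μ ∈ [0,1] of [ C·x + (1−μ)·λ + β·Σ_{d=0}^{L} P_d · Σ_{j=0}^{M} p_j · W( x − min(x,d) + μ·j ) ] is convex on [0, ∞). -/
/-- Partial minimization of a jointly convex function preserves convexity. -/
theorem convexOn_sInf_image_of_prod {E F : Type*} [AddCommGroup E] [Module ℝ E]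
    [AddCommGroup F] [Module ℝ F] {s : Set E} {t : Set F} {f : E → F → ℝ}
    (hs : Convex ℝ s) (ht : t.Nonempty)
    (hf : ConvexOn ℝ (s ×ˢ t) (fun z : E × F => f z.1 z.2))
    (hbdd : ∀ x ∈ s, BddBelow (f x '' t)) :
    ConvexOn ℝ s (fun x => sInf (f x '' t)) := by
  refine ⟨hs, fun x hx y hy a b ha hb hab => ?_⟩
  refine le_of_forall_pos_le_add fun ε hε => ?_
  obtain ⟨_, ⟨u, hu, rfl⟩, hu'⟩ :=
    exists_lt_of_csInf_lt (ht.image (f x)) (lt_add_of_pos_right (sInf (f x '' t)) hε)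
  obtain ⟨_, ⟨v, hv, rfl⟩, hv'⟩ :=
    exists_lt_of_csInf_lt (ht.image (f y)) (lt_add_of_pos_right (sInf (f y '' t)) hε)
  have hxu : (x, u) ∈ s ×ˢ t := ⟨hx, hu⟩
  have hyv : (y, v) ∈ s ×ˢ t := ⟨hy, hv⟩
  have hmem := hf.1 hxu hyv ha hb hab
  have hle : sInf (f (a • x + b • y) '' t) ≤ f (a • x + b • y) (a • u + b • v) :=
    csInf_le (hbdd _ hmem.1) ⟨_, hmem.2, rfl⟩
  have hconv : f (a • x + b • y) (a • u + b • v) ≤ a * f x u + b * f y v :=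
    hf.2 hxu hyv ha hb hab
  have hau := mul_le_mul_of_nonneg_left hu'.le ha
  have hbv := mul_le_mul_of_nonneg_left hv'.le hb
  have hε' : a * ε + b * ε = ε := by rw [← add_mul, hab, one_mul]
  simp only [smul_eq_mul]
  linarith

theorem sub_min_eq_max_sub_zero (x d : ℝ) : x - min x d = max (x - d) 0 := by
  rcases le_total x d with h | h <;> simp [h]

/-- A finite nonnegative combination of convex functions is convex. -/
theorem convexOn_sum_mul {E ι : Type*} [AddCommGroup E] [Module ℝ E] {S : Set E}
    (hS : Convex ℝ S) (I : Finset ι) {c : ι → ℝ} {g : ι → E → ℝ} (hc : ∀ i ∈ I, 0 ≤ c i)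
    (hg : ∀ i ∈ I, ConvexOn ℝ S (g i)) : ConvexOn ℝ S (fun z => ∑ i ∈ I, c i * g i z) := by
  refine ⟨hS, fun x hx y hy a b ha hb hab => ?_⟩
  simp only [smul_eq_mul, Finset.mul_sum]
  rw [← Finset.sum_add_distrib]
  refine Finset.sum_le_sum fun i hi => ?_
  have h := mul_le_mul_of_nonneg_left ((hg i hi).2 hx hy ha hb hab) (hc i hi)
  simp only [smul_eq_mul] at h
  linarith

/-- The value at the state reached from `x` after `d` departures and `u * j` arrivals is jointly
convex in `(x, u)`. -/
theorem convexOn_comp_sub_min_add_mul {W : ℝ → ℝ} (hWconv : ConvexOn ℝ (Set.Ici (0 : ℝ)) W)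
    (hWmono : MonotoneOn W (Set.Ici (0 : ℝ))) (d : ℝ) {j : ℝ} (hj : 0 ≤ j) :
    ConvexOn ℝ (Set.Ici (0 : ℝ) ×ˢ Set.Icc (0 : ℝ) 1)
      (fun z : ℝ × ℝ => W (z.1 - min z.1 d + z.2 * j)) := by
  refine ⟨(convex_Ici 0).prod (convex_Icc 0 1), ?_⟩
  rintro ⟨x, u⟩ ⟨-, hu⟩ ⟨y, v⟩ ⟨-, hv⟩ a b ha hb hab
  simp only [sub_min_eq_max_sub_zero, Prod.smul_mk, Prod.mk_add_mk, smul_eq_mul]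
  have hpos : ∀ x' u' : ℝ, 0 ≤ u' → 0 ≤ max (x' - d) 0 + u' * j := fun x' u' hu' =>
    add_nonneg (le_max_right _ _) (mul_nonneg hu' hj)
  have hX := hpos x u hu.1
  have hY := hpos y v hv.1
  have hle : max (a * x + b * y - d) 0 + (a * u + b * v) * j ≤
      a * (max (x - d) 0 + u * j) + b * (max (y - d) 0 + v * j) := by
    have h1 : max (a * x + b * y - d) 0 ≤ a * max (x - d) 0 + b * max (y - d) 0 := by
      refine max_le ?_ (by positivity)
      have h2 := mul_le_mul_of_nonneg_left (le_max_left (x - d) 0) ha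
      have h3 := mul_le_mul_of_nonneg_left (le_max_left (y - d) 0) hb
      have h4 : a * d + b * d = d := by rw [← add_mul, hab, one_mul]
      linarith
    linarith
  refine (hWmono (hpos _ _ ?_) (Set.mem_Ici.2 ?_) hle).trans
    (hWconv.2 (Set.mem_Ici.2 hX) (Set.mem_Ici.2 hY) ha hb hab)
  · exact add_nonneg (mul_nonneg ha hu.1) (mul_nonneg hb hv.1)
  · exact add_nonneg (mul_nonneg ha hX) (mul_nonneg hb hY)

/-- the one-step Bellman operator of the relaxed admission-control
problem maps convex non-decreasing functions on `[0, ∞)` to convex functions. -/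
theorem stmt_5 (W : ℝ → ℝ)
    (hWconv : ConvexOn ℝ (Set.Ici (0 : ℝ)) W)
    (hWmono : MonotoneOn W (Set.Ici (0 : ℝ)))
    (L M : ℕ) (hL : 1 ≤ L) (hM : 1 ≤ M)
    (r : ℝ) (hr0 : 0 < r) (hr1 : r < 1)
    (p : ℕ → ℝ) (hp : ∀ j, 0 ≤ p j)
    (hpsum : ∑ j ∈ Finset.range (M + 1), p j = 1)
    (C : ℝ) (hC : 0 < C) (lam : ℝ) (β : ℝ) (hβ0 : 0 < β) (hβ1 : β < 1) :
    ConvexOn ℝ (Set.Ici (0 : ℝ)) (fun x : ℝ =>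
      sInf ((fun μ : ℝ =>
        C * x + (1 - μ) * lam + β * ∑ d ∈ Finset.range (L + 1),
          ((L.choose d : ℝ) * r ^ d * (1 - r) ^ (L - d)) *
            ∑ j ∈ Finset.range (M + 1),
              p j * W (x - min x (d : ℝ) + μ * (j : ℝ)))
        '' Set.Icc (0 : ℝ) 1)) := by

  have hP : ∀ d, 0 ≤ (L.choose d : ℝ) * r ^ d * (1 - r) ^ (L - d) := fun d => by
    have : 0 ≤ 1 - r := by linarith
    positivity
  have hS : Convex ℝ (Set.Ici (0 : ℝ) ×ˢ Set.Icc (0 : ℝ) 1) :=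
    (convex_Ici 0).prod (convex_Icc 0 1)
  refine convexOn_sInf_image_of_prod (f := fun x μ => C * x + (1 - μ) * lam +
    β * ∑ d ∈ Finset.range (L + 1), ((L.choose d : ℝ) * r ^ d * (1 - r) ^ (L - d)) *
      ∑ j ∈ Finset.range (M + 1), p j * W (x - min x (d : ℝ) + μ * (j : ℝ)))
    (convex_Ici 0) ⟨0, by simp⟩ ?_ ?_
  · refine ConvexOn.add ⟨hS, fun x _ y _ a b _ _ hab => le_of_eq ?_⟩ ?_
    · simp only [Prod.fst_add, Prod.snd_add, Prod.smul_fst, Prod.smul_snd, smul_eq_mul]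
      linear_combination (-lam) * hab
    · exact (convexOn_sum_mul hS _ (fun d _ => hP d) fun d _ =>
        convexOn_sum_mul hS _ (fun j _ => hp j) fun j _ =>
          convexOn_comp_sub_min_add_mul hWconv hWmono d j.cast_nonneg).smul hβ0.le
  · intro x hx
    refine ⟨C * x - |lam| + β * ∑ d ∈ Finset.range (L + 1),
      ((L.choose d : ℝ) * r ^ d * (1 - r) ^ (L - d)) *
        ∑ j ∈ Finset.range (M + 1), p j * W 0, ?_⟩
    rintro _ ⟨μ, hμ, rfl⟩
    have hlam : -|lam| ≤ (1 - μ) * lam := by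
      have h1 := mul_le_mul_of_nonneg_left (neg_abs_le lam) (sub_nonneg.2 hμ.2)
      have h2 := mul_nonneg hμ.1 (abs_nonneg lam)
      linarith
    refine add_le_add (by linarith) (mul_le_mul_of_nonneg_left ?_ hβ0.le)
    refine Finset.sum_le_sum fun d _ => mul_le_mul_of_nonneg_left ?_ (hP d)
    refine Finset.sum_le_sum fun j _ => mul_le_mul_of_nonneg_left ?_ (hp j)
    have hpos : 0 ≤ x - min x (d : ℝ) + μ * (j : ℝ) :=
      add_nonneg (sub_nonneg.2 (min_le_left _ _)) (mul_nonneg hμ.1 j.cast_nonneg)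
    exact hWmono Set.self_mem_Ici hpos hpos
end

section
/- Fix an integer L ≥ 1, a real r ∈ (0,1), an integer M ≥ 1, and nonnegative reals p_0,...,p_M with Σ_{j=0}^{M} p_j = 1. Let V : ℕ → ℝ be monotone non-decreasing with non-decreasing differences, and define f(x) = Σ_{d=0}^{L} P_d · Σ_{q=0}^{M} p_q · ( V(max(x−d,0) + q) − V(max(x−d,0)) ) for x ∈ ℕ. Then f is monotone non-decreasing: f(x+1) ≥ f(x) for every x ∈ ℕ. (Equivalently, with D a Binomial(L,r) departure variable and A the arrival variable with law (p_q), the function x ↦ E[V((x−D)^+ + A)] − E[V((x−D)^+)] is non-decreasing, so the optimal admission policy is a threshold policy.) -/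
/-- for `V` monotone non-decreasing with non-decreasing differences,
`f(x) = E[V((x−D)⁺ + A)] − E[V((x−D)⁺)]` is monotone non-decreasing (so the
optimal admission policy is a threshold policy). Here ℕ-subtraction `x - d`
realizes `max(x − d, 0)`. -/
theorem stmt_8 (L M : ℕ) (hL : 1 ≤ L) (hM : 1 ≤ M)
    (r : ℝ) (hr0 : 0 < r) (hr1 : r < 1)
    (p : ℕ → ℝ) (hp : ∀ j, 0 ≤ p j)
    (hpsum : ∑ j ∈ Finset.range (M + 1), p j = 1)
    (V : ℕ → ℝ) (hVmono : Monotone V)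
    (hVdiff : ∀ w a b : ℕ, 0 < w → b ≤ a → V (b + w) - V b ≤ V (a + w) - V a) :
    Monotone (fun x : ℕ =>
      ∑ d ∈ Finset.range (L + 1),
        ((L.choose d : ℝ) * r ^ d * (1 - r) ^ (L - d)) *
          ∑ q ∈ Finset.range (M + 1), p q * (V (x - d + q) - V (x - d))) := by
  intro x y hxy
  refine Finset.sum_le_sum fun d _ => mul_le_mul_of_nonneg_left ?_ ?_
  · refine Finset.sum_le_sum fun q _ => mul_le_mul_of_nonneg_left ?_ (hp q)
    rcases Nat.eq_zero_or_pos q with rfl | hq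
    · simp
    · exact hVdiff q _ _ hq (Nat.sub_le_sub_right hxy d)
  · have : 0 ≤ 1 - r := by linarith
    positivity
end

section
/- Fix an integer L ≥ 1, a real r ∈ (0,1), an integer M ≥ 1, and nonnegative reals p_0,...,p_M with Σ_{j=0}^{M} p_j = 1, and assume L·r > Σ_{j=0}^{M} j·p_j. For a threshold t ∈ ℕ, let P_t be the threshold-policy transition kernel on ℕ and let v_t be an invariant probability distribution for P_t. Then Σ_{q=0}^{t} v_t(q) is a non-decreasing function of the threshold: for all natural numbers t < t' and invariant distributions v_t of P_t and v_{t'} of P_{t'}, Σ_{q=0}^{t} v_t(q) ≤ Σ_{q=0}^{t'} v_{t'}(q). -/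
/-- The transition kernel on ℕ of the queue under the threshold admission
policy with threshold `t`: arrivals are admitted exactly when the current state
is at most `t`.  ℕ-subtraction `x - d` realizes `max(x − d, 0)`. -/
noncomputable def thresholdKernel (L M : ℕ) (r : ℝ) (p : ℕ → ℝ) (t x y : ℕ) : ℝ :=
  ∑ d ∈ Finset.range (L + 1), ∑ j ∈ Finset.range (M + 1),
    ((L.choose d : ℝ) * r ^ d * (1 - r) ^ (L - d)) * p j *
      (if y = (x - d) + (if x ≤ t then j else 0) then 1 else 0)

/-- `v` is an invariant probability distribution of the threshold-`t` chain. -/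
def IsInvariantDist (L M : ℕ) (r : ℝ) (p : ℕ → ℝ) (t : ℕ) (v : ℕ → ℝ) : Prop :=
  (∀ y, 0 ≤ v y) ∧ (∑' y : ℕ, v y) = 1 ∧
    ∀ y : ℕ, v y = ∑' x : ℕ, v x * thresholdKernel L M r p t x y

/-- Expected number of admissions during `n` steps of the threshold-`t` queue started at `x`, when
the sizes of the next admitted batches are listed in `l` and all later batches are random with
weights `p`; the offered service has weights `w`. -/
noncomputable def expectedAdmissions (L M : ℕ) (w p : ℕ → ℝ) (t : ℕ) : ℕ → ℕ → List ℕ → ℝ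
  | 0, _, _ => 0
  | n + 1, x, [] =>
    if x ≤ t then
      1 + ∑ d ∈ Finset.range (L + 1), w d * ∑ j ∈ Finset.range (M + 1),
        p j * expectedAdmissions L M w p t n (x - d + j) []
    else ∑ d ∈ Finset.range (L + 1), w d * expectedAdmissions L M w p t n (x - d) []
  | n + 1, x, k :: l =>
    if x ≤ t then
      1 + ∑ d ∈ Finset.range (L + 1), w d * expectedAdmissions L M w p t n (x - d + k) l
    else ∑ d ∈ Finset.range (L + 1), w d * expectedAdmissions L M w p t n (x - d) (k :: l)

section WeightedSums

variable {N : ℕ} {w : ℕ → ℝ}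

lemma weightedSum_mono (hw : ∀ d, 0 ≤ w d) {f g : ℕ → ℝ} (h : ∀ d, f d ≤ g d) :
    ∑ d ∈ Finset.range N, w d * f d ≤ ∑ d ∈ Finset.range N, w d * g d :=
  Finset.sum_le_sum fun d _ => mul_le_mul_of_nonneg_left (h d) (hw d)

lemma weightedSum_const (h1 : ∑ d ∈ Finset.range N, w d = 1) (c : ℝ) :
    ∑ d ∈ Finset.range N, w d * c = c := by
  rw [← Finset.sum_mul, h1, one_mul]

lemma weightedSum_const_add (h1 : ∑ d ∈ Finset.range N, w d = 1) (c : ℝ) (f : ℕ → ℝ) :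
    ∑ d ∈ Finset.range N, w d * (c + f d) = c + ∑ d ∈ Finset.range N, w d * f d := by
  simp only [mul_add, Finset.sum_add_distrib, weightedSum_const h1]

end WeightedSums

section Admissions

variable {L M : ℕ} {w p : ℕ → ℝ}

lemma expectedAdmissions_nonneg (hw : ∀ d, 0 ≤ w d) (hp : ∀ j, 0 ≤ p j) (t n x : ℕ)
    (l : List ℕ) : 0 ≤ expectedAdmissions L M w p t n x l := by
  induction n generalizing x l with
  | zero => cases l <;> simp [expectedAdmissions]
  | succ n ih =>
    cases l with
    | nil =>
      rw [expectedAdmissions]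
      split_ifs
      · exact add_nonneg zero_le_one (Finset.sum_nonneg fun d _ => mul_nonneg (hw d)
          (Finset.sum_nonneg fun j _ => mul_nonneg (hp j) (ih _ _)))
      · exact Finset.sum_nonneg fun d _ => mul_nonneg (hw d) (ih _ _)
    | cons k l =>
      rw [expectedAdmissions]
      split_ifs
      · exact add_nonneg zero_le_one
          (Finset.sum_nonneg fun d _ => mul_nonneg (hw d) (ih _ _))
      · exact Finset.sum_nonneg fun d _ => mul_nonneg (hw d) (ih _ _)

lemma expectedAdmissions_le (hw : ∀ d, 0 ≤ w d) (hw1 : ∑ d ∈ Finset.range (L + 1), w d = 1)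
    (hp : ∀ j, 0 ≤ p j) (hp1 : ∑ j ∈ Finset.range (M + 1), p j = 1) (t n x : ℕ)
    (l : List ℕ) : expectedAdmissions L M w p t n x l ≤ n := by
  induction n generalizing x l with
  | zero => cases l <;> simp [expectedAdmissions]
  | succ n ih =>
    have key : ∀ f : ℕ → ℝ, (∀ d, f d ≤ n) → ∑ d ∈ Finset.range (L + 1), w d * f d ≤ n :=
      fun f hf => (weightedSum_mono hw hf).trans_eq (weightedSum_const hw1 _)
    push_cast
    cases l with
    | nil =>
      rw [expectedAdmissions]
      split_ifs
      · have := key (fun d => ∑ j ∈ Finset.range (M + 1),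
          p j * expectedAdmissions L M w p t n (x - d + j) []) fun d =>
            (weightedSum_mono hp fun j => ih (x - d + j) []).trans_eq (weightedSum_const hp1 _)
        linarith
      · linarith [key _ fun d => ih (x - d) []]
    | cons k l =>
      rw [expectedAdmissions]
      split_ifs
      · linarith [key _ fun d => ih (x - d + k) l]
      · linarith [key _ fun d => ih (x - d) (k :: l)]

/-- Revealing the size of one more future batch does not change the expectation. -/
lemma sum_expectedAdmissions_append (hp1 : ∑ j ∈ Finset.range (M + 1), p j = 1) (t n x : ℕ)
    (l : List ℕ) :
    ∑ j ∈ Finset.range (M + 1), p j * expectedAdmissions L M w p t n x (l ++ [j]) =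
      expectedAdmissions L M w p t n x l := by
  induction n generalizing x l with
  | zero => cases l <;> simp [expectedAdmissions]
  | succ n ih =>
    have swap : ∀ f : ℕ → ℕ → ℝ,
        ∑ j ∈ Finset.range (M + 1), p j * ∑ d ∈ Finset.range (L + 1), w d * f d j =
          ∑ d ∈ Finset.range (L + 1), w d * ∑ j ∈ Finset.range (M + 1), p j * f d j := by
      intro f
      simp only [Finset.mul_sum]
      rw [Finset.sum_comm]
      exact Finset.sum_congr rfl fun d _ => Finset.sum_congr rfl fun j _ => by ring
    cases l with
    | nil =>
      simp only [List.nil_append, expectedAdmissions]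
      split_ifs
      · rw [weightedSum_const_add hp1, swap]
      · rw [swap]
        exact Finset.sum_congr rfl fun d _ => by rw [← ih (x - d) []]; rfl
    | cons k l =>
      simp only [List.cons_append, expectedAdmissions]
      split_ifs
      · rw [weightedSum_const_add hp1, swap]
        simp only [ih]
      · rw [swap]
        exact Finset.sum_congr rfl fun d _ => by rw [← ih (x - d) (k :: l)]; rfl

/-- A queue with threshold `t ≤ t'` that is `l.length` batches behind, all of them listed in `l`,
never catches up with the queue of threshold `t'`. -/
lemma expectedAdmissions_le_length_add (hw : ∀ d, 0 ≤ w d)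
    (hw1 : ∑ d ∈ Finset.range (L + 1), w d = 1) (hp : ∀ j, 0 ≤ p j)
    (hp1 : ∑ j ∈ Finset.range (M + 1), p j = 1) {t t' : ℕ} (ht : t ≤ t') (n a b : ℕ)
    (l : List ℕ) (hab : b ≤ a + l.sum) :
    expectedAdmissions L M w p t n a l ≤
      l.length + expectedAdmissions L M w p t' n b [] := by
  induction n generalizing a b l with
  | zero => cases l <;> simp [expectedAdmissions]; positivity
  | succ n ih =>
    by_cases hb : b ≤ t'
    · rw [show expectedAdmissions L M w p t' (n + 1) b [] =
        1 + ∑ d ∈ Finset.range (L + 1), w d * ∑ j ∈ Finset.range (M + 1),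
          p j * expectedAdmissions L M w p t' n (b - d + j) [] by
            rw [expectedAdmissions, if_pos hb]]
      have behind : ∀ (a' : ℕ → ℕ) (l' : List ℕ), (∀ d, b - d ≤ a' d + l'.sum) →
          ∑ d ∈ Finset.range (L + 1), w d * expectedAdmissions L M w p t n (a' d) l' ≤
            (l'.length + 1 : ℝ) + ∑ d ∈ Finset.range (L + 1), w d *
              ∑ j ∈ Finset.range (M + 1),
                p j * expectedAdmissions L M w p t' n (b - d + j) [] := by
        intro a' l' h
        rw [← weightedSum_const_add hw1]
        refine weightedSum_mono hw fun d => ?_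
        rw [← weightedSum_const_add hp1, ← sum_expectedAdmissions_append hp1]
        refine weightedSum_mono hp fun j => ?_
        have := ih (a' d) (b - d + j) (l' ++ [j]) (by have := h d; simp; omega)
        simpa using this
      by_cases ha : a ≤ t
      · cases l with
        | nil =>
          rw [expectedAdmissions, if_pos ha]
          simp only [List.sum_nil, List.length_nil, Nat.cast_zero, zero_add] at hab ⊢
          gcongr with d _ j _
          · exact hw d
          · exact hp j
          · simpa using ih (a - d + j) (b - d + j) [] (by simp; omega)
        | cons k l =>
          rw [expectedAdmissions, if_pos ha]
          simp only [List.sum_cons, List.length_cons] at hab ⊢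
          have := behind (fun d => a - d + k) l (fun d => by omega)
          push_cast
          linarith
      · have := behind (fun d => a - d) l (fun d => by omega)
        cases l <;> rw [expectedAdmissions, if_neg ha] <;> linarith
    · rw [show expectedAdmissions L M w p t' (n + 1) b [] =
        ∑ d ∈ Finset.range (L + 1), w d * expectedAdmissions L M w p t' n (b - d) [] by
            rw [expectedAdmissions, if_neg hb]]
      have behind : ∀ (a' : ℕ → ℕ) (l' : List ℕ), (∀ d, b - d ≤ a' d + l'.sum) →
          ∑ d ∈ Finset.range (L + 1), w d * expectedAdmissions L M w p t n (a' d) l' ≤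
            (l'.length : ℝ) + ∑ d ∈ Finset.range (L + 1), w d *
              expectedAdmissions L M w p t' n (b - d) [] := by
        intro a' l' h
        rw [← weightedSum_const_add hw1]
        exact weightedSum_mono hw fun d => ih _ _ _ (h d)
      by_cases ha : a ≤ t
      · cases l with
        | nil => simp at hab; omega
        | cons k l =>
          rw [expectedAdmissions, if_pos ha]
          simp only [List.sum_cons, List.length_cons] at hab ⊢
          have := behind (fun d => a - d + k) l (fun d => by omega)
          push_cast
          linarith
      · have := behind (fun d => a - d) l (fun d => by omega)
        cases l <;> rw [expectedAdmissions, if_neg ha] <;> exact this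

/-- Starting from `b` instead of `0` costs at most `m` admissions, unless `m` batches do not add
up to `b`. -/
lemma expectedAdmissions_zero_le (hw : ∀ d, 0 ≤ w d)
    (hw1 : ∑ d ∈ Finset.range (L + 1), w d = 1) (hp : ∀ j, 0 ≤ p j)
    (hp1 : ∑ j ∈ Finset.range (M + 1), p j = 1) (t n b m : ℕ) (l : List ℕ) :
    expectedAdmissions L M w p t n 0 l ≤ l.length + m + expectedAdmissions L M w p t n b [] +
      n * (∑ j ∈ Finset.range (M + 1), p j * (1 / 2) ^ j) ^ m * 2 ^ b * (1 / 2) ^ l.sum := by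
  set ρ := ∑ j ∈ Finset.range (M + 1), p j * (1 / 2 : ℝ) ^ j with hρ
  induction m generalizing l with
  | zero =>
    rcases le_or_gt b l.sum with h | h
    · have h1 := expectedAdmissions_le_length_add hw hw1 hp hp1 (le_refl t) n 0 b l (by omega)
      have : (0 : ℝ) ≤ n * ρ ^ 0 * 2 ^ b * (1 / 2) ^ l.sum := by positivity
      push_cast
      linarith
    · have h1 := expectedAdmissions_le hw hw1 hp hp1 t n 0 l
      have h2 := expectedAdmissions_nonneg (L := L) (M := M) hw hp t n b []
      have h3 : (1 : ℝ) ≤ 2 ^ b * (1 / 2) ^ l.sum := by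
        rw [one_div, inv_pow, ← div_eq_mul_inv, one_le_div (by positivity)]
        exact pow_le_pow_right₀ one_le_two h.le
      have h4 : (n : ℝ) * 1 ≤ n * (2 ^ b * (1 / 2) ^ l.sum) := by gcongr
      have h5 : (0 : ℝ) ≤ l.length := by positivity
      simp only [pow_zero, mul_one, Nat.cast_zero] at h4 ⊢
      linarith
  | succ m ih =>
    rw [← sum_expectedAdmissions_append hp1]
    refine (weightedSum_mono hp fun j => ih (l ++ [j])).trans_eq ?_
    have : ∀ j, (l ++ [j]).length + m + expectedAdmissions L M w p t n b [] +
        n * ρ ^ m * 2 ^ b * (1 / 2 : ℝ) ^ (l ++ [j]).sum =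
        (l.length + (m + 1) + expectedAdmissions L M w p t n b []) +
          (n * ρ ^ m * 2 ^ b * (1 / 2) ^ l.sum) * (1 / 2) ^ j := by
      intro j
      rw [List.sum_append, List.sum_singleton, pow_add, List.length_append, List.length_singleton]
      push_cast
      ring
    simp only [this]
    rw [weightedSum_const_add hp1]
    simp only [mul_left_comm (p _), ← Finset.mul_sum, ← hρ]
    push_cast
    ring

/-- With only empty batches, the queue drains and eventually admits in every step. -/
lemma sub_mul_le_expectedAdmissions (hL : 1 ≤ L) (hw : ∀ d, 0 ≤ w d)
    (hw1 : ∑ d ∈ Finset.range (L + 1), w d = 1) (hwL : 0 < w L) (hp0 : p 0 = 1)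
    (hp : ∀ j ∈ Finset.range (M + 1), j ≠ 0 → p j = 0) (t n b : ℕ) :
    n - (w L)⁻¹ * b ≤ expectedAdmissions L M w p t n b [] := by
  induction n generalizing b with
  | zero => simp [expectedAdmissions]; positivity
  | succ n ih =>
    have hsum : ∀ f : ℕ → ℝ, ∑ j ∈ Finset.range (M + 1), p j * f j = f 0 := by
      intro f
      rw [Finset.sum_eq_single 0 (fun j hj h => by rw [hp j hj h, zero_mul]) (by simp), hp0,
        one_mul]
    have hstep := weightedSum_mono (N := L + 1) hw fun d => ih (b - d)
    have hdrain : ∑ d ∈ Finset.range (L + 1), w d * ((n : ℝ) - (w L)⁻¹ * (b - d : ℕ)) =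
        n - (w L)⁻¹ * ∑ d ∈ Finset.range (L + 1), w d * (b - d : ℕ) := by
      simp only [sub_eq_add_neg]
      rw [weightedSum_const_add hw1, Finset.mul_sum, ← Finset.sum_neg_distrib]
      congr 1
      exact Finset.sum_congr rfl fun d _ => by ring
    have hle : ∑ d ∈ Finset.range (L + 1), w d * ((b - d : ℕ) : ℝ) ≤ b := by
      refine (weightedSum_mono hw (g := fun _ => (b : ℝ)) fun d => ?_).trans_eq
        (weightedSum_const hw1 _)
      exact_mod_cast Nat.sub_le b d
    rw [hdrain] at hstep
    have hinv : 0 < (w L)⁻¹ := inv_pos.mpr hwL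
    rw [expectedAdmissions]
    simp only [hsum, add_zero]
    push_cast
    split_ifs with hb
    · have := mul_le_mul_of_nonneg_left hle hinv.le
      linarith
    · have hlt : ∑ d ∈ Finset.range (L + 1), w d * ((b - d : ℕ) : ℝ) ≤ b - w L := by
        have h1 : ∑ d ∈ Finset.range L, w d * ((b - d : ℕ) : ℝ) ≤
            ∑ d ∈ Finset.range L, w d * (b : ℝ) :=
          weightedSum_mono hw fun d => by exact_mod_cast Nat.sub_le b d
        have h2 : w L * ((b - L : ℕ) : ℝ) ≤ w L * (b - 1) := by
          gcongr
          have : b - L + 1 ≤ b := by omega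
          have : ((b - L : ℕ) : ℝ) + 1 ≤ b := by exact_mod_cast this
          linarith
        have h3 := weightedSum_const hw1 (b : ℝ)
        rw [Finset.sum_range_succ] at h3 ⊢
        linarith
      have h4 := mul_le_mul_of_nonneg_left hlt hinv.le
      rw [mul_sub, inv_mul_cancel₀ hwL.ne'] at h4
      linarith

end Admissions

section Invariant

/-- The probability that `d` packets can be served in one step. -/
noncomputable def serviceWeight (L : ℕ) (r : ℝ) (d : ℕ) : ℝ :=
  (L.choose d : ℝ) * r ^ d * (1 - r) ^ (L - d)

variable {L M : ℕ} {r : ℝ} {p : ℕ → ℝ} {t : ℕ} {v : ℕ → ℝ}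

lemma serviceWeight_nonneg (hr0 : 0 < r) (hr1 : r < 1) (d : ℕ) : 0 ≤ serviceWeight L r d := by
  have : 0 < 1 - r := sub_pos.mpr hr1
  unfold serviceWeight
  positivity

lemma sum_serviceWeight : ∑ d ∈ Finset.range (L + 1), serviceWeight L r d = 1 := by
  have h := add_pow r (1 - r) L
  rw [add_sub_cancel, one_pow] at h
  rw [h]
  exact Finset.sum_congr rfl fun d _ => by unfold serviceWeight; ring

lemma IsInvariantDist.summable (hv : IsInvariantDist L M r p t v) : Summable v := by
  by_contra h
  have := hv.2.1
  rw [tsum_eq_zero_of_not_summable h] at this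
  exact zero_ne_one this

lemma hasSum_thresholdKernel_mul (x : ℕ) (F : ℕ → ℝ) :
    HasSum (fun y => thresholdKernel L M r p t x y * F y)
      (∑ d ∈ Finset.range (L + 1), serviceWeight L r d * ∑ j ∈ Finset.range (M + 1),
        p j * F (x - d + if x ≤ t then j else 0)) := by
  have h : ∀ y, thresholdKernel L M r p t x y * F y =
      ∑ d ∈ Finset.range (L + 1), ∑ j ∈ Finset.range (M + 1), serviceWeight L r d * (p j *
        if y = x - d + (if x ≤ t then j else 0) then
          F (x - d + if x ≤ t then j else 0) else 0) := by
    intro y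
    unfold thresholdKernel serviceWeight
    simp only [Finset.sum_mul]
    refine Finset.sum_congr rfl fun d _ => Finset.sum_congr rfl fun j _ => ?_
    by_cases hy : y = x - d + (if x ≤ t then j else 0)
    · rw [if_pos hy, if_pos hy, ← hy]
      ring
    · rw [if_neg hy, if_neg hy]
      ring
  simp only [h, Finset.mul_sum]
  exact hasSum_sum fun d _ => hasSum_sum fun j _ =>
    ((hasSum_ite_eq _ _).mul_left _).mul_left _

lemma thresholdKernel_nonneg (hr0 : 0 < r) (hr1 : r < 1) (hp : ∀ j, 0 ≤ p j) (x y : ℕ) :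
    0 ≤ thresholdKernel L M r p t x y := by
  have : 0 < 1 - r := sub_pos.mpr hr1
  unfold thresholdKernel
  refine Finset.sum_nonneg fun d _ => Finset.sum_nonneg fun j _ => ?_
  have := hp j
  positivity

lemma IsInvariantDist.summable_mul (hv : IsInvariantDist L M r p t v) {F : ℕ → ℝ} {C : ℝ}
    (hF0 : ∀ x, 0 ≤ F x) (hFC : ∀ x, F x ≤ C) : Summable fun x => v x * F x :=
  (hv.summable.mul_right C).of_nonneg_of_le (fun x => mul_nonneg (hv.1 x) (hF0 x))
    fun x => mul_le_mul_of_nonneg_left (hFC x) (hv.1 x)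

lemma IsInvariantDist.tsum_mul (hv : IsInvariantDist L M r p t v) (hr0 : 0 < r) (hr1 : r < 1)
    (hp : ∀ j, 0 ≤ p j) (hp1 : ∑ j ∈ Finset.range (M + 1), p j = 1) {F : ℕ → ℝ} {C : ℝ}
    (hF0 : ∀ x, 0 ≤ F x) (hFC : ∀ x, F x ≤ C) :
    ∑' x, v x * ∑ d ∈ Finset.range (L + 1), serviceWeight L r d * ∑ j ∈ Finset.range (M + 1),
        p j * F (x - d + if x ≤ t then j else 0) = ∑' y, v y * F y := by
  have hk : ∀ x, HasSum (fun y => v x * (thresholdKernel L M r p t x y * F y)) _ :=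
    fun x => (hasSum_thresholdKernel_mul x F).mul_left (v x)
  have hw := serviceWeight_nonneg (L := L) hr0 hr1
  have hsum : Summable (Function.uncurry
      fun x y => v x * (thresholdKernel L M r p t x y * F y)) := by
    rw [summable_prod_of_nonneg]
    · refine ⟨fun x => (hk x).summable, ?_⟩
      simp only [Function.uncurry_apply_pair, (hk _).tsum_eq]
      refine hv.summable_mul (C := C) (fun x => ?_) fun x => ?_
      · exact Finset.sum_nonneg fun d _ => mul_nonneg (hw d)
          (Finset.sum_nonneg fun j _ => mul_nonneg (hp j) (hF0 _))
      · refine (weightedSum_mono hw fun d => ?_).trans_eq (weightedSum_const sum_serviceWeight C)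
        exact (weightedSum_mono hp fun j => hFC _).trans_eq (weightedSum_const hp1 C)
    · rintro ⟨x, y⟩
      exact mul_nonneg (hv.1 x) (mul_nonneg (thresholdKernel_nonneg hr0 hr1 hp x y) (hF0 y))
  calc _ = ∑' x, ∑' y, v x * (thresholdKernel L M r p t x y * F y) :=
        tsum_congr fun x => (hk x).tsum_eq.symm
    _ = ∑' y, ∑' x, v x * (thresholdKernel L M r p t x y * F y) := hsum.tsum_comm.symm
    _ = ∑' y, v y * F y := tsum_congr fun y => by
        rw [hv.2.2 y, ← tsum_mul_right]
        exact tsum_congr fun x => by ring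

/-- In stationarity, the expected number of admissions is proportional to the elapsed time. -/
lemma IsInvariantDist.tsum_mul_expectedAdmissions (hv : IsInvariantDist L M r p t v)
    (hr0 : 0 < r) (hr1 : r < 1) (hp : ∀ j, 0 ≤ p j)
    (hp1 : ∑ j ∈ Finset.range (M + 1), p j = 1) (n : ℕ) :
    ∑' x, v x * expectedAdmissions L M (serviceWeight L r) p t n x [] =
      n * ∑ q ∈ Finset.range (t + 1), v q := by
  have hw := serviceWeight_nonneg (L := L) hr0 hr1
  induction n with
  | zero => simp [expectedAdmissions]
  | succ n ih =>
    have h0 := fun x => expectedAdmissions_nonneg (L := L) (M := M) hw hp t n x []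
    have h1 := fun x => expectedAdmissions_le (L := L) hw sum_serviceWeight hp hp1 t n x []
    have hrec : ∀ x, v x * expectedAdmissions L M (serviceWeight L r) p t (n + 1) x [] =
        (if x ∈ Finset.range (t + 1) then v x else 0) +
          v x * ∑ d ∈ Finset.range (L + 1), serviceWeight L r d * ∑ j ∈ Finset.range (M + 1),
            p j * expectedAdmissions L M (serviceWeight L r) p t n
              (x - d + if x ≤ t then j else 0) [] := by
      intro x
      rw [expectedAdmissions]
      by_cases hx : x ≤ t
      · simp only [hx, if_true, Finset.mem_range, Nat.lt_succ_iff]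
        ring
      · simp only [hx, if_false, Finset.mem_range, Nat.lt_succ_iff, add_zero,
          weightedSum_const hp1, zero_add]
    have hs : Summable fun x => v x * ∑ d ∈ Finset.range (L + 1), serviceWeight L r d *
        ∑ j ∈ Finset.range (M + 1), p j * expectedAdmissions L M (serviceWeight L r) p t n
              (x - d + if x ≤ t then j else 0) [] := by
      refine hv.summable_mul (C := n) (fun x => ?_) fun x => ?_
      · exact Finset.sum_nonneg fun d _ => mul_nonneg (hw d)
          (Finset.sum_nonneg fun j _ => mul_nonneg (hp j) (h0 _))
      · refine (weightedSum_mono hw fun d => ?_).trans_eq (weightedSum_const sum_serviceWeight _)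
        exact (weightedSum_mono hp fun j => h1 _).trans_eq (weightedSum_const hp1 _)
    have hind : HasSum (fun x : ℕ => if x ∈ Finset.range (t + 1) then v x else 0)
        (∑ q ∈ Finset.range (t + 1), v q) := by
      have := hasSum_sum_of_ne_finset_zero (s := Finset.range (t + 1))
        (f := fun x => if x ∈ Finset.range (t + 1) then v x else 0)
        (L := SummationFilter.unconditional ℕ)
        fun x hx => if_neg hx
      rwa [Finset.sum_congr rfl fun x hx => if_pos hx] at this
    rw [tsum_congr hrec, hind.summable.tsum_add hs, hind.tsum_eq,
      hv.tsum_mul hr0 hr1 hp hp1 h0 h1, ih]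
    push_cast
    ring

/-- A uniform asymptotic lower bound for the expected number of admissions from every starting
state bounds the stationary admission probability. -/
lemma IsInvariantDist.le_sum_of_forall_le (hv : IsInvariantDist L M r p t v)
    (hr0 : 0 < r) (hr1 : r < 1) (hp : ∀ j, 0 ≤ p j)
    (hp1 : ∑ j ∈ Finset.range (M + 1), p j = 1) {g : ℝ}
    (h : ∀ b : ℕ, ∀ ε > 0, ∃ C, ∀ n : ℕ,
      n * g ≤ expectedAdmissions L M (serviceWeight L r) p t n b [] + C + ε * n) :
    g ≤ ∑ q ∈ Finset.range (t + 1), v q := by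
  set g' := ∑ q ∈ Finset.range (t + 1), v q with hg'
  have hw := serviceWeight_nonneg (L := L) hr0 hr1
  have hK : ∀ K, ∀ ε > 0, (∑ b ∈ Finset.range K, v b) * g ≤ g' + ε := by
    intro K ε hε
    choose C hC using fun b => h b ε hε
    have hn : ∀ n : ℕ, n * ((∑ b ∈ Finset.range K, v b) * g - g' - ε) ≤
        ∑ b ∈ Finset.range K, v b * C b := by
      intro n
      have hs := hv.summable_mul
        (fun x => expectedAdmissions_nonneg (L := L) (M := M) hw hp t n x [])
        (fun x => expectedAdmissions_le (L := L) hw sum_serviceWeight hp hp1 t n x [])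
      have h1 := hs.sum_le_tsum (Finset.range K) fun x _ => mul_nonneg (hv.1 x)
        (expectedAdmissions_nonneg hw hp t n x [])
      rw [hv.tsum_mul_expectedAdmissions hr0 hr1 hp hp1, ← hg'] at h1
      have h2 : ∑ b ∈ Finset.range K, v b ≤ 1 :=
        (hv.summable.sum_le_tsum _ fun x _ => hv.1 x).trans_eq hv.2.1
      have h3 := weightedSum_mono (N := K) hv.1 fun b => hC b n
      simp only [mul_add, Finset.sum_add_distrib, ← Finset.sum_mul] at h3
      have h4 : (∑ b ∈ Finset.range K, v b) * (ε * n) ≤ 1 * (ε * n) := by gcongr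
      linarith
    by_contra! hlt
    have hpos : 0 < (∑ b ∈ Finset.range K, v b) * g - g' - ε := by linarith
    obtain ⟨n, hn'⟩ := exists_nat_gt
      ((∑ b ∈ Finset.range K, v b * C b) / ((∑ b ∈ Finset.range K, v b) * g - g' - ε))
    rw [div_lt_iff₀ hpos] at hn'
    exact (hn n).not_gt hn'
  have hlim := (hv.summable.hasSum.tendsto_sum_nat).mul_const g
  rw [hv.2.1, one_mul] at hlim
  exact le_of_tendsto' hlim fun K => le_of_forall_pos_le_add (hK K)

end Invariant

/-- the stationary probability `Σ_{q=0}^{t} v_t(q)` of being at or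
below the threshold is non-decreasing in the threshold `t`. -/
theorem stmt_14 (L M : ℕ) (hL : 1 ≤ L) (hM : 1 ≤ M)
    (r : ℝ) (hr0 : 0 < r) (hr1 : r < 1)
    (p : ℕ → ℝ) (hp : ∀ j, 0 ≤ p j)
    (hpsum : ∑ j ∈ Finset.range (M + 1), p j = 1)
    (hstab : (L : ℝ) * r > ∑ j ∈ Finset.range (M + 1), (j : ℝ) * p j) :
    ∀ t t' : ℕ, t < t' → ∀ v v' : ℕ → ℝ,
      IsInvariantDist L M r p t v → IsInvariantDist L M r p t' v' →
      ∑ q ∈ Finset.range (t + 1), v q ≤ ∑ q ∈ Finset.range (t' + 1), v' q := by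
  intro t t' ht v v' hv hv'
  set w := serviceWeight L r with hwdef
  have hw : ∀ d, 0 ≤ w d := serviceWeight_nonneg hr0 hr1
  have hw1 : ∑ d ∈ Finset.range (L + 1), w d = 1 := sum_serviceWeight
  have hg : ∀ n : ℕ, n * ∑ q ∈ Finset.range (t + 1), v q ≤
      expectedAdmissions L M w p t' n 0 [] := by
    intro n
    rw [← hv.tsum_mul_expectedAdmissions hr0 hr1 hp hpsum]
    have hs := hv.summable_mul
      (fun x => expectedAdmissions_nonneg (L := L) (M := M) hw hp t n x [])
      (fun x => expectedAdmissions_le (L := L) hw hw1 hp hpsum t n x [])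
    calc _ ≤ ∑' x, v x * expectedAdmissions L M w p t' n 0 [] := by
          refine hs.tsum_le_tsum (fun x => mul_le_mul_of_nonneg_left ?_ (hv.1 x))
            (hv.summable.mul_right _)
          simpa using
            expectedAdmissions_le_length_add hw hw1 hp hpsum ht.le n x 0 [] (Nat.zero_le _)
      _ = expectedAdmissions L M w p t' n 0 [] := by
          rw [tsum_mul_right, hv.2.1, one_mul]
  refine hv'.le_sum_of_forall_le hr0 hr1 hp hpsum fun b ε hε => ?_
  by_cases hempty : ∀ j ∈ Finset.range (M + 1), j ≠ 0 → p j = 0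
  · have hp0 : p 0 = 1 := by
      rw [← hpsum, Finset.sum_eq_single 0 hempty (by simp)]
    have hwL : 0 < w L := by simp [hwdef, serviceWeight, hr0]
    refine ⟨(w L)⁻¹ * b, fun n => ?_⟩
    have h1 := sub_mul_le_expectedAdmissions hL hw hw1 hwL hp0 hempty t' n b
    have h2 := expectedAdmissions_le hw hw1 hp hpsum t' n 0 []
    have h3 : 0 ≤ ε * n := by positivity
    linarith [hg n]
  · push Not at hempty
    obtain ⟨k, hk, hk0, hpk⟩ := hempty
    set ρ := ∑ j ∈ Finset.range (M + 1), p j * (1 / 2 : ℝ) ^ j with hρ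
    have hρ0 : 0 ≤ ρ := Finset.sum_nonneg fun j _ => mul_nonneg (hp j) (by positivity)
    have hρ1 : ρ < 1 := by
      rw [← hpsum]
      refine Finset.sum_lt_sum (fun j _ => mul_le_of_le_one_right (hp j)
        (pow_le_one₀ (by norm_num) (by norm_num))) ⟨k, hk, ?_⟩
      exact mul_lt_of_lt_one_right ((hp k).lt_of_ne' hpk)
        (pow_lt_one₀ (by norm_num) (by norm_num) hk0)
    obtain ⟨m, hm⟩ := exists_pow_lt_of_lt_one (show 0 < ε / 2 ^ b by positivity) hρ1
    rw [lt_div_iff₀ (by positivity)] at hm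
    refine ⟨m, fun n => ?_⟩
    have h1 := expectedAdmissions_zero_le hw hw1 hp hpsum t' n b m []
    have h2 : (n : ℝ) * (ρ ^ m * 2 ^ b) ≤ n * ε := by gcongr
    simp only [List.length_nil, List.sum_nil, Nat.cast_zero, pow_zero, mul_one, zero_add,
      ← hρ] at h1
    linarith [hg n]
end

section
/- Let C > 0 and, for each k ∈ ℕ, let μ_k : ℕ → ℝ be a probability distribution on ℕ (μ_k(j) ≥ 0 for all j and Σ_{j=0}^{∞} μ_k(j) = 1) with finite mean, satisfying the monotonicity property: for all natural numbers k2 < k1, Σ_{j=0}^{k1} μ_{k1}(j) ≥ Σ_{j=0}^{k2} μ_{k2}(j). Define w(λ, k) = C·Σ_{j=0}^{∞} j·μ_k(j) + λ·Σ_{j=k+1}^{∞} μ_k(j), and suppose that for every λ ∈ ℝ the set of global minimizers of k ↦ w(λ, k) over ℕ is nonempty; let k(λ) be its least element. Then k(λ) is a non-decreasing function of λ. Consequently, the set of passive states [k(λ), ∞) shrinks monotonically as λ increases, i.e., the problem is Whittle indexable. -/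
/-- The stationary average cost under tax `lam` and threshold `k`:
`w(λ, k) = C·Σ_{j≥0} j·μ_k(j) + λ·Σ_{j≥k+1} μ_k(j)`. -/
noncomputable def statCost (C : ℝ) (μ : ℕ → ℕ → ℝ) (lam : ℝ) (k : ℕ) : ℝ :=
  C * (∑' j : ℕ, (j : ℝ) * μ k j) + lam * (∑' j : ℕ, if k + 1 ≤ j then μ k j else 0)

theorem tsum_ite_succ_le_eq_sub {f : ℕ → ℝ} {a : ℝ} (hf : HasSum f a) (k : ℕ) :
    (∑' j : ℕ, if k + 1 ≤ j then f j else 0) = a - ∑ j ∈ Finset.range (k + 1), f j := by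
  have hhead : HasSum (fun j => if j < k + 1 then f j else 0)
      (∑ j ∈ Finset.range (k + 1), f j) := by
    have h := hasSum_sum_of_ne_finset_zero (L := .unconditional ℕ) (s := Finset.range (k + 1))
      (f := fun j => if j < k + 1 then f j else 0)
      (fun j hj => if_neg (by simpa using hj))
    rwa [Finset.sum_congr rfl fun j hj => if_pos (Finset.mem_range.mp hj)] at h
  rw [← (hf.sub hhead).tsum_eq]
  refine tsum_congr fun j => ?_
  by_cases hj : j < k + 1
  · simp [hj, not_le.mpr hj]
  · simp [hj, not_lt.mp hj]

/-- under the monotone partial-sum property of the stationary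
distributions, the least minimizing threshold `k(λ)` is non-decreasing in `λ`,
hence the set of passive states `[k(λ), ∞)` shrinks monotonically as `λ`
increases: the problem is Whittle indexable. -/
theorem stmt_15 (C : ℝ) (hC : 0 < C) (μ : ℕ → ℕ → ℝ)
    (hμ0 : ∀ k j, 0 ≤ μ k j) (hμ1 : ∀ k, HasSum (μ k) 1)
    (hmean : ∀ k, Summable (fun j : ℕ => (j : ℝ) * μ k j))
    (hmono : ∀ k2 k1 : ℕ, k2 < k1 →
      ∑ j ∈ Finset.range (k2 + 1), μ k2 j ≤ ∑ j ∈ Finset.range (k1 + 1), μ k1 j)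
    (hnonempty : ∀ lam : ℝ,
      {k : ℕ | ∀ k' : ℕ, statCost C μ lam k ≤ statCost C μ lam k'}.Nonempty)
    (lam1 lam2 : ℝ) (hlam : lam2 ≤ lam1) (k1 k2 : ℕ)
    (h1 : IsLeast {k : ℕ | ∀ k' : ℕ, statCost C μ lam1 k ≤ statCost C μ lam1 k'} k1)
    (h2 : IsLeast {k : ℕ | ∀ k' : ℕ, statCost C μ lam2 k ≤ statCost C μ lam2 k'} k2) :
    k2 ≤ k1 ∧ Set.Ici k1 ⊆ Set.Ici k2 := by
  have hle : k2 ≤ k1 := by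
    by_contra! hlt
    refine absurd (h2.2 fun k' => ?_) (not_le.mpr hlt)
    have hk1 := h1.1 k2
    have hk2 := h2.1 k'
    have hsum := hmono k1 k2 hlt
    simp only [statCost, tsum_ite_succ_le_eq_sub (hμ1 _)] at hk1 hk2 ⊢
    linarith [mul_nonneg (sub_nonneg.mpr hlam) (sub_nonneg.mpr hsum)]
  exact ⟨hle, Set.Ici_subset_Ici.mpr hle⟩
end
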